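/- arXiv:2310.16216 — 3 statements merged into one kernel-verified Lean document; each statement's English description precedes it below -/
import Mathlib

section
/- Let y ∈ ℂ^m with B y ≠ 0, and set p₀ = y* A12^T A11^{-1} A12 y, q₀ = y* (A22 + γ B^T Q^{-1} B) y, t₀ = α y* B^T Q^{-1} B y, b = 1 + (p₀ + t₀)/(q₀ + (1 − γ/α) t₀), and c = t₀/(q₀ + (1 − γ/α) t₀). Then c > 0 and b ≥ 1 + c. -/
open Matrix

namespace Matrix

variable {ι κ : Type*} [Fintype ι] [Fintype κ]

/-- The real part of the Hermitian form of a real matrix splits into the quadratic forms of the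
real and imaginary parts of the vector. -/
lemma re_star_dotProduct_map_ofReal_mulVec (M : Matrix ι ι ℝ) (y : ι → ℂ) :
    (star y ⬝ᵥ (M.map Complex.ofReal *ᵥ y)).re =
      (fun i ↦ (y i).re) ⬝ᵥ (M *ᵥ fun i ↦ (y i).re) +
        (fun i ↦ (y i).im) ⬝ᵥ (M *ᵥ fun i ↦ (y i).im) := by
  simp [dotProduct, mulVec, Finset.sum_add_distrib]

lemma PosSemidef.re_star_dotProduct_map_ofReal_mulVec_nonneg {M : Matrix ι ι ℝ}
    (hM : M.PosSemidef) (y : ι → ℂ) : 0 ≤ (star y ⬝ᵥ (M.map Complex.ofReal *ᵥ y)).re := by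
  rw [re_star_dotProduct_map_ofReal_mulVec]
  exact add_nonneg (by simpa using hM.dotProduct_mulVec_nonneg fun i ↦ (y i).re)
    (by simpa using hM.dotProduct_mulVec_nonneg fun i ↦ (y i).im)

lemma PosDef.re_star_dotProduct_map_ofReal_mulVec_pos {M : Matrix ι ι ℝ}
    (hM : M.PosDef) {y : ι → ℂ} (hy : y ≠ 0) :
    0 < (star y ⬝ᵥ (M.map Complex.ofReal *ᵥ y)).re := by
  rw [re_star_dotProduct_map_ofReal_mulVec]
  have hre := hM.posSemidef.dotProduct_mulVec_nonneg fun i ↦ (y i).re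
  have him := hM.posSemidef.dotProduct_mulVec_nonneg fun i ↦ (y i).im
  simp only [star_trivial] at hre him
  by_cases h : (fun i ↦ (y i).re) = 0
  · have h' : (fun i ↦ (y i).im) ≠ 0 := fun h' ↦
      hy <| funext fun i ↦ Complex.ext (congrFun h i) (congrFun h' i)
    exact add_pos_of_nonneg_of_pos hre (by simpa using hM.dotProduct_mulVec_pos h')
  · exact add_pos_of_pos_of_nonneg (by simpa using hM.dotProduct_mulVec_pos h) him

lemma star_dotProduct_map_ofReal_transpose_mul_mul_mulVec (M : Matrix κ κ ℝ) (B : Matrix κ ι ℝ)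
    (y : ι → ℂ) :
    star y ⬝ᵥ ((Bᵀ * M * B).map Complex.ofReal *ᵥ y) =
      star (B.map Complex.ofReal *ᵥ y) ⬝ᵥ
        (M.map Complex.ofReal *ᵥ (B.map Complex.ofReal *ᵥ y)) := by
  have hB : (B.map Complex.ofReal)ᴴ = Bᵀ.map Complex.ofReal := by
    ext
    simp
  have hmul : (Bᵀ * M * B).map Complex.ofReal =
      Bᵀ.map Complex.ofReal * M.map Complex.ofReal * B.map Complex.ofReal := by
    ext
    simp [mul_apply]
  rw [hmul, star_mulVec, hB, ← dotProduct_mulVec, mulVec_mulVec, mulVec_mulVec]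

end Matrix

/-- With `p₀ = y* A12ᵀ A11⁻¹ A12 y`, `q₀ = y* (A22 + γ Bᵀ Q⁻¹ B) y`,
`t₀ = α y* Bᵀ Q⁻¹ B y` (real numbers), `b = 1 + (p₀ + t₀)/(q₀ + (1 − γ/α) t₀)`
and `c = t₀/(q₀ + (1 − γ/α) t₀)`: if `B y ≠ 0` then `c > 0` and `b ≥ 1 + c`. -/
theorem stmt8 (n m p : ℕ) (hn : 0 < n) (hm : 0 < m) (hp : 0 < p)
    (A11 : Matrix (Fin n) (Fin n) ℝ) (A22 : Matrix (Fin m) (Fin m) ℝ)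
    (A12 : Matrix (Fin n) (Fin m) ℝ) (B : Matrix (Fin p) (Fin m) ℝ)
    (Q : Matrix (Fin p) (Fin p) ℝ)
    (hA11 : A11.PosDef) (hA22 : A22.PosDef) (hB : B.rank = p) (hQ : Q.PosDef)
    (γ α : ℝ) (hγ : 0 < γ) (hγα : γ ≤ α)
    (y : Fin m → ℂ) (hBy : (B.map Complex.ofReal) *ᵥ y ≠ 0)
    (p0 q0 t0 b c : ℝ)
    (hp0 : p0 = (star y ⬝ᵥ (((A12ᵀ * A11⁻¹ * A12).map Complex.ofReal) *ᵥ y)).re)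
    (hq0 : q0 = (star y ⬝ᵥ (((A22 + γ • (Bᵀ * Q⁻¹ * B)).map Complex.ofReal) *ᵥ y)).re)
    (ht0 : t0 = α * (star y ⬝ᵥ (((Bᵀ * Q⁻¹ * B).map Complex.ofReal) *ᵥ y)).re)
    (hb : b = 1 + (p0 + t0) / (q0 + (1 - γ / α) * t0))
    (hc : c = t0 / (q0 + (1 - γ / α) * t0)) :
    0 < c ∧ 1 + c ≤ b := by
  have hp0_nonneg : 0 ≤ p0 := by
    rw [hp0, star_dotProduct_map_ofReal_transpose_mul_mul_mulVec]
    exact hA11.inv.posSemidef.re_star_dotProduct_map_ofReal_mulVec_nonneg _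
  have hs : 0 < (star y ⬝ᵥ ((Bᵀ * Q⁻¹ * B).map Complex.ofReal *ᵥ y)).re := by
    rw [star_dotProduct_map_ofReal_transpose_mul_mul_mulVec]
    exact hQ.inv.re_star_dotProduct_map_ofReal_mulVec_pos hBy
  have ha := hA22.posSemidef.re_star_dotProduct_map_ofReal_mulVec_nonneg y
  have hq : q0 = (star y ⬝ᵥ (A22.map Complex.ofReal *ᵥ y)).re +
      γ * (star y ⬝ᵥ ((Bᵀ * Q⁻¹ * B).map Complex.ofReal *ᵥ y)).re := by
    rw [hq0]
    simp only [re_star_dotProduct_map_ofReal_mulVec, add_mulVec, smul_mulVec, dotProduct_add,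
      dotProduct_smul, smul_eq_mul]
    ring
  have hα : 0 < α := hγ.trans_le hγα
  have ht : 0 < t0 := ht0 ▸ mul_pos hα hs
  have hd : 0 < q0 + (1 - γ / α) * t0 := by
    have : q0 + (1 - γ / α) * t0 = (star y ⬝ᵥ (A22.map Complex.ofReal *ᵥ y)).re + t0 := by
      rw [hq, ht0]
      field_simp
      ring
    rw [this]
    exact add_pos_of_nonneg_of_pos ha ht
  rw [hb, hc]
  exact ⟨div_pos ht hd, by gcongr; linarith⟩
end

section
/- Let y ∈ ℂ^m be nonzero, and set p₀ = y* A12^T A11^{-1} A12 y, q₀ = y* (A22 + γ B^T Q^{-1} B) y, t₀ = α y* B^T Q^{-1} B y, and b = 1 + (p₀ + t₀)/(q₀ + (1 − γ/α) t₀). Then b < 2 + λ_max(A12^T A11^{-1} A12)/λ_min(A22). -/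
open Matrix

section Helpers

open scoped ComplexOrder

variable {n : Type*} [Fintype n]

theorem Matrix.IsHermitian.posSemidef_sub_smul_one {𝕜 : Type*} [RCLike 𝕜] [DecidableEq n]
    {A : Matrix n n 𝕜} (hA : A.IsHermitian) {c : ℝ} (hc : ∀ i, c ≤ hA.eigenvalues i) :
    (A - (c : 𝕜) • (1 : Matrix n n 𝕜)).PosSemidef := by
  have h : A - (c : 𝕜) • (1 : Matrix n n 𝕜) =
      (hA.eigenvectorUnitary : Matrix n n 𝕜) *
        diagonal (fun i => ((hA.eigenvalues i - c : ℝ) : 𝕜)) *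
        star (hA.eigenvectorUnitary : Matrix n n 𝕜) := by
    have hd : diagonal (fun i => ((hA.eigenvalues i - c : ℝ) : 𝕜)) =
        diagonal (RCLike.ofReal ∘ hA.eigenvalues) - (c : 𝕜) • (1 : Matrix n n 𝕜) := by
      rw [smul_one_eq_diagonal, diagonal_sub]
      simp
    conv_lhs => rw [hA.spectral_theorem, Unitary.conjStarAlgAut_apply]
    rw [hd, mul_sub, sub_mul, mul_smul_comm, mul_one, smul_mul_assoc,
      Unitary.mul_star_self_of_mem hA.eigenvectorUnitary.2]
  rw [h]
  refine (PosSemidef.diagonal fun i => ?_).mul_mul_conjTranspose_same _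
  exact RCLike.ofReal_nonneg.2 (sub_nonneg.2 (hc i))

theorem Matrix.IsHermitian.posSemidef_smul_one_sub {𝕜 : Type*} [RCLike 𝕜] [DecidableEq n]
    {A : Matrix n n 𝕜} (hA : A.IsHermitian) {c : ℝ} (hc : ∀ i, hA.eigenvalues i ≤ c) :
    ((c : 𝕜) • (1 : Matrix n n 𝕜) - A).PosSemidef := by
  have h : (c : 𝕜) • (1 : Matrix n n 𝕜) - A =
      (hA.eigenvectorUnitary : Matrix n n 𝕜) *
        diagonal (fun i => ((c - hA.eigenvalues i : ℝ) : 𝕜)) *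
        star (hA.eigenvectorUnitary : Matrix n n 𝕜) := by
    have hd : diagonal (fun i => ((c - hA.eigenvalues i : ℝ) : 𝕜)) =
        (c : 𝕜) • (1 : Matrix n n 𝕜) - diagonal (RCLike.ofReal ∘ hA.eigenvalues) := by
      rw [smul_one_eq_diagonal, diagonal_sub]
      simp
    conv_lhs => rw [hA.spectral_theorem, Unitary.conjStarAlgAut_apply]
    rw [hd, mul_sub, sub_mul, mul_smul_comm, mul_one, smul_mul_assoc,
      Unitary.mul_star_self_of_mem hA.eigenvectorUnitary.2]
  rw [h]
  refine (PosSemidef.diagonal fun i => ?_).mul_mul_conjTranspose_same _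
  exact RCLike.ofReal_nonneg.2 (sub_nonneg.2 (hc i))

theorem Matrix.re_star_dotProduct_map_ofReal_mulVec_s11 (M : Matrix n n ℝ) (y : n → ℂ) :
    (star y ⬝ᵥ ((M.map Complex.ofReal) *ᵥ y)).re =
      (fun i => (y i).re) ⬝ᵥ (M *ᵥ fun i => (y i).re) +
        (fun i => (y i).im) ⬝ᵥ (M *ᵥ fun i => (y i).im) := by
  simp [dotProduct, mulVec, Complex.re_sum, Complex.im_sum, Finset.sum_add_distrib]

theorem Matrix.PosSemidef.re_star_dotProduct_map_ofReal_nonneg {M : Matrix n n ℝ}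
    (hM : M.PosSemidef) (y : n → ℂ) :
    0 ≤ (star y ⬝ᵥ ((M.map Complex.ofReal) *ᵥ y)).re := by
  rw [re_star_dotProduct_map_ofReal_mulVec_s11]
  exact add_nonneg (hM.dotProduct_mulVec_nonneg _) (hM.dotProduct_mulVec_nonneg _)

theorem Matrix.re_star_dotProduct_map_ofReal_add (M N : Matrix n n ℝ) (c : ℝ) (y : n → ℂ) :
    (star y ⬝ᵥ (((M + c • N).map Complex.ofReal) *ᵥ y)).re =
      (star y ⬝ᵥ ((M.map Complex.ofReal) *ᵥ y)).re +
        c * (star y ⬝ᵥ ((N.map Complex.ofReal) *ᵥ y)).re := by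
  simp only [re_star_dotProduct_map_ofReal_mulVec_s11, add_mulVec, smul_mulVec, dotProduct_add,
    dotProduct_smul, smul_eq_mul]
  ring

theorem Matrix.re_star_dotProduct_one_pos [DecidableEq n] {y : n → ℂ} (hy : y ≠ 0) :
    0 < (star y ⬝ᵥ (((1 : Matrix n n ℝ).map Complex.ofReal) *ᵥ y)).re := by
  rw [Matrix.map_one _ Complex.ofReal_zero Complex.ofReal_one, one_mulVec]
  exact (Complex.pos_iff.1 (dotProduct_star_self_pos_iff.2 hy)).1

end Helpers

/-- For any nonzero `y`, the quantity `b = 1 + (p₀ + t₀)/(q₀ + (1 − γ/α) t₀)`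
satisfies `b < 2 + λ_max(A12ᵀ A11⁻¹ A12)/λ_min(A22)`. -/
theorem stmt11 (n m p : ℕ) (hn : 0 < n) (hm : 0 < m) (hp : 0 < p)
    (A11 : Matrix (Fin n) (Fin n) ℝ) (A22 : Matrix (Fin m) (Fin m) ℝ)
    (A12 : Matrix (Fin n) (Fin m) ℝ) (B : Matrix (Fin p) (Fin m) ℝ)
    (Q : Matrix (Fin p) (Fin p) ℝ)
    (hA11 : A11.PosDef) (hA22 : A22.PosDef) (hB : B.rank = p) (hQ : Q.PosDef)
    (hH : (A12ᵀ * A11⁻¹ * A12).IsHermitian)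
    (γ α : ℝ) (hγ : 0 < γ) (hγα : γ ≤ α)
    (y : Fin m → ℂ) (hy : y ≠ 0)
    (p0 q0 t0 b : ℝ)
    (hp0 : p0 = (star y ⬝ᵥ (((A12ᵀ * A11⁻¹ * A12).map Complex.ofReal) *ᵥ y)).re)
    (hq0 : q0 = (star y ⬝ᵥ (((A22 + γ • (Bᵀ * Q⁻¹ * B)).map Complex.ofReal) *ᵥ y)).re)
    (ht0 : t0 = α * (star y ⬝ᵥ (((Bᵀ * Q⁻¹ * B).map Complex.ofReal) *ᵥ y)).re)
    (hb : b = 1 + (p0 + t0) / (q0 + (1 - γ / α) * t0)) :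
    b < 2 + (⨆ i, hH.eigenvalues i) / (⨅ i, hA22.1.eigenvalues i) := by
  have : Nonempty (Fin m) := ⟨⟨0, hm⟩⟩
  set W := Bᵀ * Q⁻¹ * B
  have hWpsd : W.PosSemidef := hQ.inv.posSemidef.conjTranspose_mul_mul_same B
  have hHpsd : (A12ᵀ * A11⁻¹ * A12).PosSemidef :=
    hA11.inv.posSemidef.conjTranspose_mul_mul_same A12
  set L := ⨆ i, hH.eigenvalues i
  set l := ⨅ i, hA22.1.eigenvalues i with hl
  have hL0 : 0 ≤ L := Real.iSup_nonneg fun i => hHpsd.eigenvalues_nonneg i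
  have hl0 : 0 < l := by
    obtain ⟨i, hi⟩ := exists_eq_ciInf_of_finite (f := hA22.1.eigenvalues)
    rw [hl, ← hi]
    exact hA22.eigenvalues_pos i
  have hupper : (L • (1 : Matrix (Fin m) (Fin m) ℝ) - A12ᵀ * A11⁻¹ * A12).PosSemidef :=
    hH.posSemidef_smul_one_sub fun i => le_ciSup (Set.finite_range _).bddAbove i
  have hlower : (A22 - l • (1 : Matrix (Fin m) (Fin m) ℝ)).PosSemidef :=
    hA22.1.posSemidef_sub_smul_one fun i => ciInf_le (Set.finite_range _).bddBelow i
  have hU := re_star_dotProduct_map_ofReal_add (L • (1 : Matrix (Fin m) (Fin m) ℝ) -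
    A12ᵀ * A11⁻¹ * A12) (A12ᵀ * A11⁻¹ * A12) 1 y
  have hU' := re_star_dotProduct_map_ofReal_add 0 (1 : Matrix (Fin m) (Fin m) ℝ) L y
  have hV := re_star_dotProduct_map_ofReal_add (A22 - l • (1 : Matrix (Fin m) (Fin m) ℝ))
    1 l y
  have hN := re_star_dotProduct_one_pos hy
  have hw := hWpsd.re_star_dotProduct_map_ofReal_nonneg y
  have hu := hupper.re_star_dotProduct_map_ofReal_nonneg y
  have hv := hlower.re_star_dotProduct_map_ofReal_nonneg y
  have hzero : (star y ⬝ᵥ (((0 : Matrix (Fin m) (Fin m) ℝ).map Complex.ofReal) *ᵥ y)).re = 0 := by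
    simp
  rw [one_smul, sub_add_cancel, one_mul, ← hp0] at hU
  rw [zero_add, hzero, zero_add] at hU'
  rw [sub_add_cancel] at hV
  rw [re_star_dotProduct_map_ofReal_add] at hq0
  set N := (star y ⬝ᵥ (((1 : Matrix (Fin m) (Fin m) ℝ).map Complex.ofReal) *ᵥ y)).re
  set w := (star y ⬝ᵥ ((W.map Complex.ofReal) *ᵥ y)).re
  set s := (star y ⬝ᵥ ((A22.map Complex.ofReal) *ᵥ y)).re
  have hα : 0 < α := hγ.trans_le hγα
  have hden : q0 + (1 - γ / α) * t0 = s + α * w := by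
    rw [hq0, ht0]
    field_simp
    ring
  have hpL : p0 ≤ L * N := by linarith
  have hsl : l * N ≤ s := by linarith
  have hs : 0 < s := (mul_pos hl0 hN).trans_le hsl
  have ht : 0 ≤ α * w := mul_nonneg hα.le hw
  have hkey : p0 ≤ L / l * s := calc
    p0 ≤ L / l * (l * N) := by rwa [← mul_assoc, div_mul_cancel₀ _ hl0.ne']
    _ ≤ L / l * s := mul_le_mul_of_nonneg_left hsl (div_nonneg hL0 hl0.le)
  have hfrac : (p0 + t0) / (s + α * w) < 1 + L / l := by
    rw [div_lt_iff₀ (by positivity), ht0]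
    nlinarith [mul_nonneg (div_nonneg hL0 hl0.le) ht]
  rw [hb, hden]
  linarith
end

section
/- Fix real numbers p₀ ≥ 0, s > 0, r > 0 and γ > 0, and for α ≥ γ define q₀ = s + γ r, t₀(α) = α r, b(α) = 1 + (p₀ + t₀(α))/(q₀ + (1 − γ/α) t₀(α)), and c(α) = t₀(α)/(q₀ + (1 − γ/α) t₀(α)). Then b(α) → 2 and c(α) → 1 as α → ∞, and consequently both roots λ₁(α) = (b(α) − √(b(α)² − 4c(α)))/2 and λ₂(α) = (b(α) + √(b(α)² − 4c(α)))/2 of the quadratic λ² − b(α) λ + c(α) = 0 tend to 1 as α → ∞. -/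
open Filter

/-- For fixed `p₀ ≥ 0`, `s > 0`, `r > 0`, `γ > 0`, with `q₀ = s + γ r`,
`t₀(α) = α r`, `b(α) = 1 + (p₀ + t₀(α))/(q₀ + (1 − γ/α) t₀(α))` and
`c(α) = t₀(α)/(q₀ + (1 − γ/α) t₀(α))`, one has `b(α) → 2` and `c(α) → 1` as
`α → ∞`, and both roots
`λ₁(α) = (b(α) − √(b(α)² − 4c(α)))/2`, `λ₂(α) = (b(α) + √(b(α)² − 4c(α)))/2`
of `λ² − b(α) λ + c(α) = 0` tend to `1` as `α → ∞`. -/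
theorem stmt15 (p0 s r γ : ℝ) (hp0 : 0 ≤ p0) (hs : 0 < s) (hr : 0 < r)
    (hγ : 0 < γ) (q0 : ℝ) (hq0 : q0 = s + γ * r)
    (t0 b c lam1 lam2 : ℝ → ℝ)
    (ht0 : ∀ α, t0 α = α * r)
    (hb : ∀ α, b α = 1 + (p0 + t0 α) / (q0 + (1 - γ / α) * t0 α))
    (hc : ∀ α, c α = t0 α / (q0 + (1 - γ / α) * t0 α))
    (hlam1 : ∀ α, lam1 α = (b α - Real.sqrt ((b α) ^ 2 - 4 * c α)) / 2)
    (hlam2 : ∀ α, lam2 α = (b α + Real.sqrt ((b α) ^ 2 - 4 * c α)) / 2) :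
    Tendsto b atTop (nhds 2) ∧ Tendsto c atTop (nhds 1) ∧
    (∀ᶠ α in atTop, (lam1 α) ^ 2 - b α * lam1 α + c α = 0) ∧
    (∀ᶠ α in atTop, (lam2 α) ^ 2 - b α * lam2 α + c α = 0) ∧
    Tendsto lam1 atTop (nhds 1) ∧ Tendsto lam2 atTop (nhds 1) := by
  have hD : Tendsto (fun α : ℝ => s + α * r) atTop atTop :=
    tendsto_atTop_add_const_left _ _ (tendsto_id.atTop_mul_const hr)
  have hdenom : ∀ α : ℝ, 0 < α → q0 + (1 - γ / α) * t0 α = s + α * r := by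
    intro α hα
    rw [hq0, ht0]
    field_simp
    ring
  have hc_eq : ∀ α : ℝ, 0 < α → c α = 1 - s / (s + α * r) := by
    intro α hα
    have : 0 < s + α * r := by positivity
    rw [hc, hdenom α hα, ht0]
    field_simp
    ring
  have hb_eq : ∀ α : ℝ, 0 < α → b α = 1 + c α + p0 / (s + α * r) := by
    intro α hα
    rw [hb, hc, hdenom α hα]
    ring
  have hc_lim : Tendsto c atTop (nhds 1) := by
    have h : Tendsto (fun α : ℝ => 1 - s / (s + α * r)) atTop (nhds 1) := by
      simpa using (hD.const_div_atTop s).const_sub 1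
    refine h.congr' ?_
    filter_upwards [eventually_gt_atTop 0] with α hα using (hc_eq α hα).symm
  have hb_lim : Tendsto b atTop (nhds 2) := by
    have h := (hc_lim.const_add 1).add (hD.const_div_atTop p0)
    norm_num at h
    refine h.congr' ?_
    filter_upwards [eventually_gt_atTop 0] with α hα using (hb_eq α hα).symm
  have hdiscr : ∀ α : ℝ, 0 < α → 0 ≤ (b α) ^ 2 - 4 * c α := by
    intro α hα
    have he : 0 ≤ p0 / (s + α * r) := by positivity
    have hc0 : 0 ≤ c α := by
      rw [hc, hdenom α hα, ht0]
      positivity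
    rw [hb_eq α hα]
    nlinarith [sq_nonneg (1 - c α), mul_nonneg he hc0]
  have hsqrt : Tendsto (fun α => Real.sqrt ((b α) ^ 2 - 4 * c α)) atTop (nhds 0) := by
    have h := ((hb_lim.pow 2).sub (hc_lim.const_mul 4)).sqrt
    norm_num at h
    exact h
  refine ⟨hb_lim, hc_lim, ?_, ?_, ?_, ?_⟩
  · filter_upwards [eventually_gt_atTop 0] with α hα
    rw [hlam1]
    linear_combination Real.sq_sqrt (hdiscr α hα) / 4
  · filter_upwards [eventually_gt_atTop 0] with α hα
    rw [hlam2]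
    linear_combination Real.sq_sqrt (hdiscr α hα) / 4
  · rw [funext hlam1]
    simpa using (hb_lim.sub hsqrt).div_const 2
  · rw [funext hlam2]
    simpa using (hb_lim.add hsqrt).div_const 2
end
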